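/- arXiv:2406.15922 — 2 statements merged into one kernel-verified Lean document; each statement's English description precedes it below -/
import Mathlib

section
/- A positive linear map η : Mₘ(ℂ) → Mₘ(ℂ) is indecomposable if and only if there exists a unique positive definite matrix c ∈ Mₘ(ℂ) with det(c) = 1 and det(η(c)) = cap(η) (i.e., the infimum defining the capacity is attained at a unique matrix). -/
open ComplexOrder Matrix

/-- The capacity of a map `η` on `m × m` complex matrices:
`cap(η) = inf { det(η(b)) : b positive definite, det(b) = 1 }`,
where `det(η(b))` is read off as the (real) value `(det (η b)).re`
(for positive maps `η`, `det (η b)` is a nonnegative real number). -/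
noncomputable def cap {m : ℕ}
    (η : Matrix (Fin m) (Fin m) ℂ → Matrix (Fin m) (Fin m) ℂ) : ℝ :=
  sInf { x : ℝ | ∃ b : Matrix (Fin m) (Fin m) ℂ,
    b.PosDef ∧ b.det = 1 ∧ ((η b).det).re = x }

section FiniteIndex

variable {n : Type*} [Fintype n] [DecidableEq n]

theorem exists_unitary_mul_diagonal_mul {M : Matrix n n ℂ} (hM : M.IsHermitian) :
    ∃ U ∈ unitaryGroup n ℂ, ∃ μ : n → ℝ,
      M = U * diagonal (fun i => (μ i : ℂ)) * Uᴴ := by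
  refine ⟨hM.eigenvectorUnitary, hM.eigenvectorUnitary.2, hM.eigenvalues, ?_⟩
  conv_lhs => rw [hM.spectral_theorem]
  rfl

theorem exists_unitary_mul_diagonal_mul_monotone {m : ℕ} {M : Matrix (Fin m) (Fin m) ℂ}
    (hM : M.IsHermitian) :
    ∃ U ∈ unitaryGroup (Fin m) ℂ, ∃ μ : Fin m → ℝ, Monotone μ ∧
      M = U * diagonal (fun i => (μ i : ℂ)) * Uᴴ := by
  obtain ⟨U, hU, μ, h⟩ := exists_unitary_mul_diagonal_mul hM
  set σ := Tuple.sort μ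
  refine ⟨U.submatrix id σ, ?_, μ ∘ σ, Tuple.monotone_sort μ, ?_⟩
  · rw [mem_unitaryGroup_iff, star_eq_conjTranspose, conjTranspose_submatrix,
      submatrix_mul_equiv, ← star_eq_conjTranspose, mem_unitaryGroup_iff.1 hU, submatrix_id_id]
  · have : diagonal (fun i => (((μ ∘ σ) i : ℝ) : ℂ)) =
        (diagonal (fun i => (μ i : ℂ))).submatrix σ σ := by
      rw [submatrix_diagonal_equiv]; rfl
    rw [this, conjTranspose_submatrix, submatrix_mul_equiv, submatrix_mul_equiv, submatrix_id_id]
    exact h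

theorem Matrix.PosDef.exists_mul_conjTranspose {c : Matrix n n ℂ} (hc : c.PosDef) :
    ∃ A : Matrix n n ℂ, IsUnit A ∧ c = A * Aᴴ := by
  obtain ⟨U, hU, μ, h⟩ := exists_unitary_mul_diagonal_mul hc.1
  have hUu : IsUnit U := (Unitary.toUnits ⟨U, hU⟩).isUnit
  have hμ : ∀ i, 0 < μ i := by
    rw [h, ← star_eq_conjTranspose, IsUnit.posDef_star_right_conjugate_iff hUu,
      posDef_diagonal_iff] at hc
    intro i
    exact_mod_cast hc i
  have key : c = (U * diagonal (fun i => (√(μ i) : ℂ))) *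
      (U * diagonal (fun i => (√(μ i) : ℂ)))ᴴ := by
    rw [conjTranspose_mul, diagonal_conjTranspose]
    have : diagonal (fun i => (μ i : ℂ)) = diagonal (fun i => (√(μ i) : ℂ)) *
        diagonal (star (fun i => (√(μ i) : ℂ))) := by
      rw [diagonal_mul_diagonal]
      congr 1
      ext i
      simp [← Complex.ofReal_mul, Real.mul_self_sqrt (hμ i).le]
    rw [h, this]
    simp only [Matrix.mul_assoc]
  refine ⟨_, ?_, key⟩
  rw [isUnit_iff_isUnit_det, isUnit_iff_ne_zero]
  intro h0
  have := hc.det_pos.ne'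
  rw [key, det_mul, h0, zero_mul] at this
  exact this rfl

/-- A positive definite matrix and a Hermitian matrix are simultaneously diagonalised by a
congruence. -/
theorem exists_simultaneous_congruence {c b : Matrix n n ℂ} (hc : c.PosDef) (hb : b.IsHermitian) :
    ∃ A : Matrix n n ℂ, IsUnit A ∧ c = A * Aᴴ ∧
      ∃ μ : n → ℝ, b = A * diagonal (fun i => (μ i : ℂ)) * Aᴴ := by
  obtain ⟨C, hC, rfl⟩ := hc.exists_mul_conjTranspose
  have hCd : IsUnit C.det := (isUnit_iff_isUnit_det C).1 hC
  obtain ⟨U, hU, μ, h⟩ := exists_unitary_mul_diagonal_mul (isHermitian_mul_mul_conjTranspose C⁻¹ hb)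
  have hUU : U * Uᴴ = 1 := mem_unitaryGroup_iff.1 hU
  refine ⟨C * U, hC.mul (Unitary.toUnits ⟨U, hU⟩).isUnit, ?_, μ, ?_⟩
  · rw [conjTranspose_mul, Matrix.mul_assoc, ← Matrix.mul_assoc U, hUU, Matrix.one_mul]
  · calc b = C * (C⁻¹ * b * C⁻¹ᴴ) * Cᴴ := by
          rw [← Matrix.mul_assoc, ← Matrix.mul_assoc, mul_nonsing_inv _ hCd, Matrix.one_mul,
            Matrix.mul_assoc, ← conjTranspose_mul, mul_nonsing_inv _ hCd, conjTranspose_one,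
            Matrix.mul_one]
      _ = _ := by
          rw [h, conjTranspose_mul]
          simp only [Matrix.mul_assoc]

theorem Matrix.PosSemidef.apply_eq_zero_of_diag_eq_zero {M : Matrix n n ℂ} (hM : M.PosSemidef)
    {j : n} (hj : M j j = 0) (i : n) : M i j = 0 := by
  have h := (hM.dotProduct_mulVec_zero_iff (Pi.single j 1)).1 (by simpa using hj)
  simpa using congrFun h i

theorem Matrix.PosSemidef.rank_le_card_of_diag_eq_zero {M : Matrix n n ℂ} (hM : M.PosSemidef)
    (T : Finset n) (hT : ∀ j ∉ T, M j j = 0) : M.rank ≤ T.card := by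
  classical
  have : M = M * diagonal (fun j => if j ∈ T then (1 : ℂ) else 0) := by
    ext i j
    by_cases hj : j ∈ T
    · simp [hj]
    · simp [hj, hM.apply_eq_zero_of_diag_eq_zero (hT j hj)]
  rw [this]
  refine (rank_mul_le_right _ _).trans ?_
  rw [rank_diagonal]
  simp

theorem rank_mul_mul_conjTranspose_of_isUnit {A : Matrix n n ℂ} (hA : IsUnit A)
    (X : Matrix n n ℂ) : (A * X * Aᴴ).rank = X.rank := by
  have h := (isUnit_iff_isUnit_det A).1 hA
  rw [rank_mul_eq_left_of_isUnit_det, rank_mul_eq_right_of_isUnit_det _ _ h]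
  rw [det_conjTranspose]
  exact h.star

theorem posDef_mul_mul_conjTranspose_iff {A : Matrix n n ℂ} (hA : IsUnit A)
    {X : Matrix n n ℂ} : (A * X * Aᴴ).PosDef ↔ X.PosDef :=
  IsUnit.posDef_star_right_conjugate_iff hA

theorem posSemidef_mul_mul_conjTranspose_iff {A : Matrix n n ℂ} (hA : IsUnit A)
    {X : Matrix n n ℂ} : (A * X * Aᴴ).PosSemidef ↔ X.PosSemidef :=
  IsUnit.posSemidef_star_right_conjugate_iff hA

end FiniteIndex

section DoublyStochastic

theorem posSemidef_single_one {n : Type*} [DecidableEq n] (i : n) :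
    (single i i (1 : ℂ)).PosSemidef := by
  rw [← diagonal_single, posSemidef_diagonal_iff]
  intro j
  by_cases h : j = i
  · subst h; simp
  · simp [h]

variable {n : Type*} [Fintype n] [DecidableEq n]

/-- A positive linear map on matrices which is unital and preserves the trace of the diagonal
matrix units. -/
structure IsDoublyStochasticMap (ξ : Matrix n n ℂ →ₗ[ℂ] Matrix n n ℂ) : Prop where
  posSemidef : ∀ x : Matrix n n ℂ, x.PosSemidef → (ξ x).PosSemidef
  map_one : ξ 1 = 1
  trace_single : ∀ i, (ξ (single i i 1)).trace.re = 1

/-- The matrix of a linear map on matrices with respect to the diagonal matrix units. -/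
def diagWeight (ξ : Matrix n n ℂ →ₗ[ℂ] Matrix n n ℂ) (j i : n) : ℝ :=
  (ξ (single i i 1) j j).re

theorem diagonal_eq_sum_smul_single (d : n → ℂ) :
    diagonal d = ∑ i, d i • single i i (1 : ℂ) := by
  simp only [smul_single, smul_eq_mul, mul_one]
  exact (sum_single_eq_diagonal d).symm

theorem re_map_diagonal_apply (ξ : Matrix n n ℂ →ₗ[ℂ] Matrix n n ℂ) (μ : n → ℝ) (j : n) :
    (ξ (diagonal fun i => (μ i : ℂ)) j j).re = ∑ i, diagWeight ξ j i * μ i := by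
  rw [diagonal_eq_sum_smul_single, map_sum, Matrix.sum_apply, Complex.re_sum]
  refine Finset.sum_congr rfl fun i _ => ?_
  rw [map_smul, Matrix.smul_apply, smul_eq_mul, Complex.re_ofReal_mul, diagWeight, mul_comm]

namespace IsDoublyStochasticMap

variable {ξ : Matrix n n ℂ →ₗ[ℂ] Matrix n n ℂ}

theorem diagWeight_nonneg (h : IsDoublyStochasticMap ξ) (j i : n) : 0 ≤ diagWeight ξ j i :=
  (Complex.nonneg_iff.1 ((h.posSemidef _ (posSemidef_single_one i)).diag_nonneg (i := j))).1

theorem sum_diagWeight_left (h : IsDoublyStochasticMap ξ) (i : n) : ∑ j, diagWeight ξ j i = 1 := by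
  rw [← h.trace_single i, trace, Complex.re_sum]
  rfl

theorem sum_diagWeight_right (h : IsDoublyStochasticMap ξ) (j : n) : ∑ i, diagWeight ξ j i = 1 := by
  have := re_map_diagonal_apply ξ (fun _ => 1) j
  simpa [h.map_one] using this.symm

end IsDoublyStochasticMap

theorem trace_re_eq_one_of_det_le {ξ : Matrix n n ℂ →ₗ[ℂ] Matrix n n ℂ} (h1 : ξ 1 = 1)
    (h : ∀ x : Matrix n n ℂ, x.PosDef → x.det.re ≤ (ξ x).det.re) (i : n) :
    (ξ (single i i 1)).trace.re = 1 := by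
  set X := ξ (single i i 1) with hX
  set p : Polynomial ℂ := (1 + (Polynomial.X : Polynomial ℂ) • X.map Polynomial.C).det with hp
  have hpe : ∀ t : ℂ, p.eval t = (1 + t • X).det := by
    intro t
    rw [hp, ← Polynomial.coe_evalRingHom t, RingHom.map_det]
    congr 1
    ext a b
    by_cases hab : a = b <;> simp [hab] <;> ring
  have hd : HasDerivAt (fun t : ℝ => ((p.eval (t : ℂ)).re - (1 + t))) (X.trace.re - 1) 0 := by
    have h2 : HasDerivAt (fun t : ℂ => p.eval t) X.trace ((0 : ℝ) : ℂ) := by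
      have := p.hasDerivAt ((0 : ℝ) : ℂ)
      rwa [Complex.ofReal_zero, hp, derivative_det_one_add_X_smul] at this
    exact h2.real_of_complex.sub ((hasDerivAt_id (0 : ℝ)).const_add 1)
  have hmin : IsLocalMin (fun t : ℝ => ((p.eval (t : ℂ)).re - (1 + t))) 0 := by
    filter_upwards [Ioo_mem_nhds (show (-1 : ℝ) < 0 by norm_num) (show (0 : ℝ) < 1 by norm_num)]
      with t ht
    have hdiag : (1 : Matrix n n ℂ) + (t : ℂ) • single i i 1 =
        diagonal (fun j => if j = i then 1 + (t : ℂ) else 1) := by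
      ext a b
      by_cases hab : a = b
      · subst hab
        by_cases hai : a = i
        · subst hai; simp
        · simp [hai, Ne.symm hai]
      · simp [hab, single_apply]
        rintro rfl rfl
        exact absurd rfl hab
    have hpd : ((1 : Matrix n n ℂ) + (t : ℂ) • single i i 1).PosDef := by
      rw [hdiag, posDef_diagonal_iff]
      intro j
      have : (0 : ℝ) < 1 + t := by linarith [ht.1]
      split_ifs
      · exact_mod_cast this
      · exact one_pos
    have key := h _ hpd
    rw [map_add, map_smul, h1, ← hX, ← hpe, hdiag, det_diagonal, Finset.prod_ite_eq'] at key
    simp at key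
    have h0 : p.eval 0 = 1 := by rw [hpe]; simp
    simp [h0]
    linarith
  have := hmin.hasDerivAt_eq_zero hd
  linarith

/-- Rescaling a positive map at a minimiser of the normalised determinant gives a doubly
stochastic map, which can moreover be chosen diagonal at a given Hermitian matrix. -/
theorem exists_doublyStochastic_scaling {η : Matrix n n ℂ →ₗ[ℂ] Matrix n n ℂ}
    (hpos : ∀ x : Matrix n n ℂ, x.PosSemidef → (η x).PosSemidef)
    {c b : Matrix n n ℂ} (hc : c.PosDef) (hηc : (η c).PosDef) (hb : b.IsHermitian)
    (hηb : (η b).IsHermitian)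
    (hmin : ∀ x : Matrix n n ℂ, x.PosDef → (η c).det.re * x.det.re ≤ c.det.re * (η x).det.re) :
    ∃ A B : Matrix n n ℂ, ∃ l μ : n → ℝ, ∃ ξ : Matrix n n ℂ →ₗ[ℂ] Matrix n n ℂ,
      IsUnit A ∧ IsUnit B ∧ c = A * Aᴴ ∧ η c = B * Bᴴ ∧
      b = A * diagonal (fun i => (l i : ℂ)) * Aᴴ ∧
      η b = B * diagonal (fun i => (μ i : ℂ)) * Bᴴ ∧
      (∀ x, η (A * x * Aᴴ) = B * ξ x * Bᴴ) ∧ IsDoublyStochasticMap ξ := by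
  obtain ⟨A, hA, hcA, l, hbA⟩ := exists_simultaneous_congruence hc hb
  obtain ⟨B, hB, hcB, μ, hbB⟩ := exists_simultaneous_congruence hηc hηb
  have hBd : IsUnit B.det := (isUnit_iff_isUnit_det B).1 hB
  have hB1 : B * B⁻¹ = 1 := mul_nonsing_inv _ hBd
  have hB2 : B⁻¹ᴴ * Bᴴ = 1 := by rw [← conjTranspose_mul, hB1, conjTranspose_one]
  let ξ : Matrix n n ℂ →ₗ[ℂ] Matrix n n ℂ :=
    { toFun := fun x => B⁻¹ * η (A * x * Aᴴ) * B⁻¹ᴴ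
      map_add' := fun x y => by simp only [Matrix.mul_add, Matrix.add_mul, map_add]
      map_smul' := fun r x => by
        simp only [Matrix.mul_smul, Matrix.smul_mul, map_smul, RingHom.id_apply] }
  have hξ : ∀ x, η (A * x * Aᴴ) = B * ξ x * Bᴴ := fun x => by
    change _ = B * (B⁻¹ * η (A * x * Aᴴ) * B⁻¹ᴴ) * Bᴴ
    rw [Matrix.mul_assoc B⁻¹, ← Matrix.mul_assoc B, hB1, Matrix.one_mul,
      Matrix.mul_assoc (η _), hB2, Matrix.mul_one]
  have hξ1 : ξ 1 = 1 := by
    change B⁻¹ * η (A * 1 * Aᴴ) * B⁻¹ᴴ = 1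
    rw [Matrix.mul_one, ← hcA, hcB, ← Matrix.mul_assoc, nonsing_inv_mul _ hBd, Matrix.one_mul,
      ← conjTranspose_mul, nonsing_inv_mul _ hBd, conjTranspose_one]
  have hdet : ∀ (C x : Matrix n n ℂ), (C * x * Cᴴ).det.re = Complex.normSq C.det * x.det.re := by
    intro C x
    rw [det_mul, det_mul, det_conjTranspose, mul_right_comm, Complex.star_def, Complex.mul_conj,
      Complex.re_ofReal_mul]
  have hns : ∀ C : Matrix n n ℂ, (C * Cᴴ).det.re = Complex.normSq C.det := by
    intro C
    simpa using hdet C 1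
  refine ⟨A, B, l, μ, ξ, hA, hB, hcA, hcB, hbA, hbB, hξ, ?_, hξ1, ?_⟩
  · intro x hx
    rw [← posSemidef_mul_mul_conjTranspose_iff hB, ← hξ]
    exact hpos _ (hx.mul_mul_conjTranspose_same A)
  · refine trace_re_eq_one_of_det_le hξ1 fun x hx => ?_
    have := hmin _ ((posDef_mul_mul_conjTranspose_iff hA).2 hx)
    rw [hξ, hdet, hdet, hcB, hcA, hns, hns] at this
    have hp : 0 < Complex.normSq B.det * Complex.normSq A.det :=
      mul_pos (Complex.normSq_pos.2 hBd.ne_zero)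
        (Complex.normSq_pos.2 ((isUnit_iff_isUnit_det A).1 hA).ne_zero)
    refine le_of_mul_le_mul_left ?_ hp
    linarith

end DoublyStochastic

section Uniqueness

variable {n : Type*} [Fintype n] [DecidableEq n]

/-- The diagonal projection onto the coordinates in `S`. -/
def coordProj {n : Type*} [DecidableEq n] (S : Finset n) : Matrix n n ℂ :=
  diagonal fun i => (((if i ∈ S then 1 else 0 : ℝ)) : ℂ)

theorem posSemidef_coordProj {n : Type*} [DecidableEq n] (S : Finset n) :
    (coordProj S).PosSemidef := by
  rw [coordProj, posSemidef_diagonal_iff]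
  intro i
  split_ifs <;> simp

theorem rank_coordProj (S : Finset n) : (coordProj S).rank = S.card := by
  classical
  rw [coordProj, rank_diagonal]
  simp

namespace IsDoublyStochasticMap

variable {ξ : Matrix n n ℂ →ₗ[ℂ] Matrix n n ℂ}

theorem map_coordProj_apply_diag (h : IsDoublyStochasticMap ξ) (S : Finset n) (j : n) :
    ξ (coordProj S) j j = ((∑ i ∈ S, diagWeight ξ j i : ℝ) : ℂ) := by
  have h0 := (h.posSemidef _ (posSemidef_coordProj S)).diag_nonneg (i := j)
  have h1 := re_map_diagonal_apply ξ (fun i => if i ∈ S then 1 else 0) j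
  apply Complex.ext
  · rw [coordProj, h1]
    simp
  · simpa using (Complex.nonneg_iff.1 h0).2.symm

theorem rank_map_coordProj_le (h : IsDoublyStochasticMap ξ) {S T : Finset n}
    (hST : ∀ j ∉ T, ∀ i ∈ S, diagWeight ξ j i = 0) : (ξ (coordProj S)).rank ≤ T.card := by
  refine (h.posSemidef _ (posSemidef_coordProj S)).rank_le_card_of_diag_eq_zero T fun j hj => ?_
  rw [h.map_coordProj_apply_diag, Finset.sum_eq_zero (hST j hj), Complex.ofReal_zero]

/-- Equality case of Jensen's inequality for the logarithm. -/
theorem diagWeight_eq_zero_of_prod_eq_one (h : IsDoublyStochasticMap ξ) {l μ : n → ℝ}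
    (hl : ∀ i, 0 < l i) (hμ : ∀ j, 0 < μ j)
    (hlμ : ∀ j, μ j = ∑ i, diagWeight ξ j i * l i) (hl1 : ∏ i, l i = 1) (hμ1 : ∏ j, μ j = 1)
    {j i : n} (hij : l i ≠ μ j) : diagWeight ξ j i = 0 := by
  have hlog : ∀ x : ℝ, 0 < x → 0 ≤ x - 1 - Real.log x := fun x hx => by
    linarith [Real.log_le_sub_one_of_pos hx]
  have hnn : ∀ j i, 0 ≤ diagWeight ξ j i * (l i / μ j - 1 - Real.log (l i / μ j)) := fun j i =>
    mul_nonneg (h.diagWeight_nonneg j i) (hlog _ (div_pos (hl i) (hμ j)))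
  have hrow : ∀ j, ∑ i, diagWeight ξ j i * (l i / μ j - 1 - Real.log (l i / μ j)) =
      Real.log (μ j) - ∑ i, diagWeight ξ j i * Real.log (l i) := by
    intro j
    have : ∀ i, diagWeight ξ j i * (l i / μ j - 1 - Real.log (l i / μ j)) =
        (diagWeight ξ j i * l i) / μ j + diagWeight ξ j i * (Real.log (μ j) - 1) -
          diagWeight ξ j i * Real.log (l i) := by
      intro i
      rw [Real.log_div (hl i).ne' (hμ j).ne']
      ring
    simp_rw [this]
    rw [Finset.sum_sub_distrib, Finset.sum_add_distrib, ← Finset.sum_div, ← hlμ, ← Finset.sum_mul,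
      h.sum_diagWeight_right, div_self (hμ j).ne']
    ring
  have htot : ∑ j, ∑ i, diagWeight ξ j i * (l i / μ j - 1 - Real.log (l i / μ j)) = 0 := by
    simp_rw [hrow]
    rw [Finset.sum_sub_distrib, Finset.sum_comm]
    simp_rw [← Finset.sum_mul, h.sum_diagWeight_left, one_mul]
    rw [← Real.log_prod (fun j _ => (hμ j).ne'), ← Real.log_prod (fun i _ => (hl i).ne'), hl1, hμ1,
      sub_self]
  have h1 := (Finset.sum_eq_zero_iff_of_nonneg
    (fun j _ => Finset.sum_nonneg fun i _ => hnn j i)).1 htot j (Finset.mem_univ j)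
  have h2 := (Finset.sum_eq_zero_iff_of_nonneg (fun i _ => hnn j i)).1 h1 i (Finset.mem_univ i)
  refine (mul_eq_zero.1 h2).resolve_right (ne_of_gt ?_)
  have : l i / μ j ≠ 1 := fun hh => hij ((div_eq_one_iff_eq (hμ j).ne').1 hh)
  linarith [Real.log_lt_sub_one_of_pos (div_pos (hl i) (hμ j)) this]

end IsDoublyStochasticMap

theorem det_mul_diagonal_mul_conjTranspose (A : Matrix n n ℂ) (l : n → ℝ) :
    (A * diagonal (fun i => (l i : ℂ)) * Aᴴ).det = (A * Aᴴ).det * ((∏ i, l i : ℝ) : ℂ) := by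
  simp only [det_mul, det_diagonal, Complex.ofReal_prod]
  ring

theorem minimizer_unique {η : Matrix n n ℂ →ₗ[ℂ] Matrix n n ℂ}
    (hpos : ∀ x : Matrix n n ℂ, x.PosSemidef → (η x).PosSemidef)
    (hind : ∀ b : Matrix n n ℂ, b.PosSemidef → 1 ≤ b.rank → b.rank < Fintype.card n →
      b.rank < (η b).rank)
    {c b : Matrix n n ℂ} (hc : c.PosDef) (hηc : (η c).PosDef) (hb : b.PosDef)
    (hmin : ∀ x : Matrix n n ℂ, x.PosDef → (η c).det.re * x.det.re ≤ c.det.re * (η x).det.re)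
    (hbc : b.det = c.det) (hηbc : (η b).det = (η c).det) : b = c := by
  obtain ⟨A, B, l, μ, ξ, hA, hB, hcA, hcB, hbA, hbB, hξ, hds⟩ :=
    exists_doublyStochastic_scaling hpos hc hηc hb.1 (hpos b hb.posSemidef).1 hmin
  have hηb : (η b).PosDef :=
    (hpos b hb.posSemidef).posDef_iff_det_ne_zero.2 (hηbc ▸ hηc.det_pos.ne')
  have hl : ∀ i, 0 < l i := by
    rw [hbA, posDef_mul_mul_conjTranspose_iff hA, posDef_diagonal_iff] at hb
    exact fun i => by exact_mod_cast hb i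
  have hμ : ∀ i, 0 < μ i := by
    rw [hbB, posDef_mul_mul_conjTranspose_iff hB, posDef_diagonal_iff] at hηb
    exact fun i => by exact_mod_cast hηb i
  have hl1 : ∏ i, l i = 1 := by
    rw [hbA, det_mul_diagonal_mul_conjTranspose, ← hcA] at hbc
    exact_mod_cast mul_eq_left₀ hc.det_pos.ne' |>.1 hbc
  have hμ1 : ∏ i, μ i = 1 := by
    rw [hbB, det_mul_diagonal_mul_conjTranspose, ← hcB] at hηbc
    exact_mod_cast mul_eq_left₀ hηc.det_pos.ne' |>.1 hηbc
  have hξl : ξ (diagonal fun i => (l i : ℂ)) = diagonal fun i => (μ i : ℂ) := by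
    have h1 := hξ (diagonal fun i => (l i : ℂ))
    rw [← hbA, hbB] at h1
    have hBs : IsUnit Bᴴ := hB.star
    exact (hB.mul_left_cancel (hBs.mul_right_cancel h1)).symm
  have hlμ : ∀ j, μ j = ∑ i, diagWeight ξ j i * l i := by
    intro j
    rw [← re_map_diagonal_apply, hξl]
    simp
  have hD : ∀ j i, l i ≠ μ j → diagWeight ξ j i = 0 := fun j i =>
    hds.diagWeight_eq_zero_of_prod_eq_one hl hμ hlμ hl1 hμ1
  have hconst : ∀ i i', l i' = l i := by
    intro i₀ i'
    set S := Finset.univ.filter fun i => l i = l i₀ with hS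
    set T := Finset.univ.filter fun j => μ j = l i₀ with hT
    have hTS : T.card ≤ S.card := by
      have h1 : ((T.card : ℕ) : ℝ) = ∑ j ∈ T, ∑ i ∈ S, diagWeight ξ j i := by
        rw [Finset.card_eq_sum_ones, Nat.cast_sum]
        refine Finset.sum_congr rfl fun j hj => ?_
        rw [Nat.cast_one, ← hds.sum_diagWeight_right j]
        symm
        refine Finset.sum_subset (Finset.subset_univ _) fun i _ hi => hD j i ?_
        rw [hT, Finset.mem_filter] at hj
        rw [hj.2]
        simpa [hS] using hi
      have h2 : ∑ j ∈ T, ∑ i ∈ S, diagWeight ξ j i ≤ ((S.card : ℕ) : ℝ) := by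
        rw [Finset.sum_comm, Finset.card_eq_sum_ones, Nat.cast_sum]
        refine Finset.sum_le_sum fun i _ => ?_
        rw [Nat.cast_one, ← hds.sum_diagWeight_left i]
        exact Finset.sum_le_univ_sum_of_nonneg fun j => hds.diagWeight_nonneg j i
      exact_mod_cast h1.trans_le h2
    have hr : (ξ (coordProj S)).rank ≤ T.card := by
      refine hds.rank_map_coordProj_le fun j hj i hi => hD j i ?_
      rw [hS, Finset.mem_filter] at hi
      rw [hi.2]
      simpa [hT, eq_comm] using hj
    have hnot : ¬ S.card < Fintype.card n := by
      intro hlt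
      have := hind (A * coordProj S * Aᴴ) ((posSemidef_coordProj S).mul_mul_conjTranspose_same A)
      rw [hξ, rank_mul_mul_conjTranspose_of_isUnit hA, rank_mul_mul_conjTranspose_of_isUnit hB,
        rank_coordProj] at this
      have h1 : 1 ≤ S.card := Finset.card_pos.2 ⟨i₀, by simp [hS]⟩
      have := this h1 hlt
      omega
    have huniv : S = Finset.univ :=
      (Finset.card_eq_iff_eq_univ S).1 (le_antisymm (Finset.card_le_univ S) (not_lt.1 hnot))
    have : i' ∈ S := huniv ▸ Finset.mem_univ i'
    rw [hS, Finset.mem_filter] at this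
    exact this.2
  have hone : ∀ i, l i = 1 := by
    intro i
    have : l i ^ Fintype.card n = 1 := by
      rw [← hl1, Finset.prod_congr rfl fun i' _ => hconst i i']
      simp
    have : Nonempty n := ⟨i⟩
    exact (pow_eq_one_iff_of_nonneg (hl i).le Fintype.card_ne_zero).1 ‹l i ^ _ = 1›
  rw [hbA, hcA]
  simp [hone]

end Uniqueness

section Nonuniqueness

variable {n : Type*} [Fintype n] [DecidableEq n]

theorem IsDoublyStochasticMap.map_coordProj_eq {ξ : Matrix n n ℂ →ₗ[ℂ] Matrix n n ℂ}
    (h : IsDoublyStochasticMap ξ) {S T : Finset n}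
    (hST : ∀ j ∉ T, ∀ i ∈ S, diagWeight ξ j i = 0) (hcard : T.card ≤ S.card) :
    T.card = S.card ∧ ξ (coordProj S) = coordProj T := by
  have h1 : ((S.card : ℕ) : ℝ) = ∑ j ∈ T, ∑ i ∈ S, diagWeight ξ j i := by
    rw [Finset.sum_comm, Finset.card_eq_sum_ones, Nat.cast_sum]
    refine Finset.sum_congr rfl fun i hi => ?_
    rw [Nat.cast_one, ← h.sum_diagWeight_left i]
    exact (Finset.sum_subset (Finset.subset_univ _) fun j _ hj => hST j hj i hi).symm
  have h2 : ∀ j ∈ T, ∑ i ∈ S, diagWeight ξ j i ≤ 1 := fun j _ => by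
    rw [← h.sum_diagWeight_right j]
    exact Finset.sum_le_univ_sum_of_nonneg fun i => h.diagWeight_nonneg j i
  have h3 : ∑ j ∈ T, (1 : ℝ) = T.card := by simp
  have h4 : T.card = S.card := by
    refine le_antisymm hcard ?_
    have := Finset.sum_le_sum h2
    rw [← h1, h3] at this
    exact_mod_cast this
  have h5 : ∀ j ∈ T, ∑ i ∈ S, diagWeight ξ j i = 1 :=
    (Finset.sum_eq_sum_iff_of_le h2).1 (by rw [← h1, h3, h4])
  refine ⟨h4, ?_⟩
  have hN := h.posSemidef _ (posSemidef_coordProj S)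
  have hN' : (1 - ξ (coordProj S)).PosSemidef := by
    have : ξ (coordProj Sᶜ) = 1 - ξ (coordProj S) := by
      rw [← h.map_one, ← map_sub]
      congr 1
      rw [coordProj, coordProj, ← diagonal_one, diagonal_sub]
      congr 1
      ext i
      by_cases hi : i ∈ S <;> simp [hi]
    rw [← this]
    exact h.posSemidef _ (posSemidef_coordProj _)
  have hdiag : ∀ j, ξ (coordProj S) j j = if j ∈ T then 1 else 0 := by
    intro j
    rw [h.map_coordProj_apply_diag]
    split_ifs with hj
    · rw [h5 j hj, Complex.ofReal_one]
    · rw [Finset.sum_eq_zero (hST j hj), Complex.ofReal_zero]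
  ext i j
  by_cases hij : i = j
  · subst hij
    rw [hdiag, coordProj, diagonal_apply_eq]
    split_ifs <;> simp
  · rw [show coordProj T i j = 0 from diagonal_apply_ne _ hij]
    by_cases hj : j ∈ T
    · have := hN'.apply_eq_zero_of_diag_eq_zero (j := j) (by simp [hdiag, hj]) i
      simpa [hij] using this
    · exact hN.apply_eq_zero_of_diag_eq_zero (by simp [hdiag, hj]) i

theorem diagonal_ite_eq {n : Type*} [DecidableEq n] (S : Finset n) (t s : ℝ) :
    diagonal (fun i => (((if i ∈ S then t else s) : ℝ) : ℂ)) =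
      (t : ℂ) • coordProj S + (s : ℂ) • (1 - coordProj S) := by
  rw [coordProj, ← diagonal_one, diagonal_sub, ← diagonal_smul, ← diagonal_smul, diagonal_add]
  congr 1
  ext i
  by_cases hi : i ∈ S <;> simp [hi]

theorem prod_ite_mem_eq_one {S : Finset n} :
    ∏ i, (if i ∈ S then (2 : ℝ) ^ (Fintype.card n - S.card) else (2 ^ S.card)⁻¹) = 1 := by
  rw [Finset.prod_ite, Finset.prod_const, Finset.prod_const, Finset.filter_mem_eq_inter,
    Finset.univ_inter, Finset.filter_not, Finset.filter_mem_eq_inter, Finset.univ_inter,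
    Finset.card_sdiff_of_subset (Finset.subset_univ _), Finset.card_univ, ← pow_mul, inv_pow, ← pow_mul,
    mul_comm, mul_comm S.card]
  exact inv_mul_cancel₀ (by positivity)

theorem det_map_eq_zero {η : Matrix n n ℂ →ₗ[ℂ] Matrix n n ℂ}
    (hpos : ∀ x : Matrix n n ℂ, x.PosSemidef → (η x).PosSemidef)
    {c x : Matrix n n ℂ} (hc : c.PosDef) (hx : x.PosSemidef) (h0 : (η c).det = 0) :
    (η x).det = 0 := by
  obtain ⟨A, -, hcA, l, hxA⟩ := exists_simultaneous_congruence hc hx.1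
  set K : ℝ := ∑ i, |l i|
  have hK : ((K : ℂ) • c - x).PosSemidef := by
    have : (K : ℂ) • c - x = A * diagonal (fun i => ((K - l i : ℝ) : ℂ)) * Aᴴ := by
      have : diagonal (fun i => ((K - l i : ℝ) : ℂ)) =
          (K : ℂ) • (1 : Matrix n n ℂ) - diagonal (fun i => (l i : ℂ)) := by
        rw [← diagonal_one, ← diagonal_smul, diagonal_sub]
        congr 1
        ext i
        simp
      rw [this, Matrix.mul_sub, Matrix.sub_mul, ← hxA, Matrix.mul_smul, Matrix.smul_mul,
        Matrix.mul_one, ← hcA]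
    rw [this]
    refine PosSemidef.mul_mul_conjTranspose_same ?_ A
    rw [posSemidef_diagonal_iff]
    intro i
    have : l i ≤ K := (le_abs_self _).trans
      (Finset.single_le_sum (f := fun i => |l i|) (fun _ _ => abs_nonneg _) (Finset.mem_univ i))
    exact_mod_cast sub_nonneg.2 this
  obtain ⟨v, hv, hv0⟩ := exists_mulVec_eq_zero_iff.2 h0
  refine exists_mulVec_eq_zero_iff.1 ⟨v, hv, ?_⟩
  rw [← (hpos x hx).dotProduct_mulVec_zero_iff]
  refine le_antisymm ?_ ((hpos x hx).dotProduct_mulVec_nonneg v)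
  have := (hpos _ hK).dotProduct_mulVec_nonneg v
  rw [map_sub, map_smul, sub_mulVec, smul_mulVec, hv0, smul_zero, zero_sub, dotProduct_neg] at this
  exact neg_nonneg.1 this

theorem exists_ne_minimizer {η : Matrix n n ℂ →ₗ[ℂ] Matrix n n ℂ}
    (hpos : ∀ x : Matrix n n ℂ, x.PosSemidef → (η x).PosSemidef)
    {c b : Matrix n n ℂ} (hc : c.PosDef) (hb : b.PosSemidef)
    (hmin : ∀ x : Matrix n n ℂ, x.PosDef → (η c).det.re * x.det.re ≤ c.det.re * (η x).det.re)
    (hb1 : 1 ≤ b.rank) (hbn : b.rank < Fintype.card n) (hηb : (η b).rank ≤ b.rank) :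
    ∃ c' : Matrix n n ℂ, c' ≠ c ∧ c'.PosDef ∧ c'.det = c.det ∧ (η c').det = (η c).det := by
  have key : ∀ A : Matrix n n ℂ, IsUnit A → c = A * Aᴴ → ∀ S : Finset n, 1 ≤ S.card →
      S.card < Fintype.card n → ∀ c', c' = A * diagonal (fun i => (((if i ∈ S then
        (2 : ℝ) ^ (Fintype.card n - S.card) else (2 ^ S.card)⁻¹) : ℝ) : ℂ)) * Aᴴ →
      c' ≠ c ∧ c'.PosDef ∧ c'.det = c.det := by
    intro A hA hcA S hS1 hSn c' hc'
    refine ⟨?_, ?_, ?_⟩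
    · rw [hc', hcA]
      intro heq
      have hAs : IsUnit Aᴴ := hA.star
      have h1 := hAs.mul_right_cancel heq
      have h2 := hA.mul_left_cancel (h1.trans (Matrix.mul_one A).symm)
      obtain ⟨i, hi⟩ := Finset.card_pos.1 hS1
      have h3 := congrFun (congrFun h2 i) i
      rw [diagonal_apply_eq, if_pos hi, one_apply_eq] at h3
      have h4 : (2 : ℝ) ^ (Fintype.card n - S.card) = 1 := by exact_mod_cast h3
      have h5 : (1 : ℝ) < 2 ^ (Fintype.card n - S.card) := one_lt_pow₀ (by norm_num) (by omega)
      exact h5.ne' h4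
    · rw [hc', posDef_mul_mul_conjTranspose_iff hA, posDef_diagonal_iff]
      intro i
      have : (0 : ℝ) < if i ∈ S then
        (2 : ℝ) ^ (Fintype.card n - S.card) else (2 ^ S.card)⁻¹ := by
        split_ifs <;> positivity
      exact_mod_cast this
    · rw [hc', det_mul_diagonal_mul_conjTranspose, ← hcA, prod_ite_mem_eq_one]
      simp
  have hrank : ∀ A : Matrix n n ℂ, IsUnit A → ∀ l : n → ℝ,
      (A * diagonal (fun i => (l i : ℂ)) * Aᴴ).rank =
        (Finset.univ.filter fun i => l i ≠ 0).card := by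
    classical
    intro A hA l
    rw [rank_mul_mul_conjTranspose_of_isUnit hA, rank_diagonal, Fintype.card_subtype]
    simp
  have hl0 : ∀ A : Matrix n n ℂ, IsUnit A → ∀ l : n → ℝ,
      (A * diagonal (fun i => (l i : ℂ)) * Aᴴ).PosSemidef → ∀ i, 0 ≤ l i := by
    intro A hA l h i
    rw [posSemidef_mul_mul_conjTranspose_iff hA, posSemidef_diagonal_iff] at h
    exact_mod_cast h i
  by_cases h0 : (η c).det = 0
  · obtain ⟨A, hA, hcA, l, hbA⟩ := exists_simultaneous_congruence hc hb.1
    have hr := hrank A hA l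
    rw [← hbA] at hr
    rw [hr] at hb1 hbn
    obtain ⟨h1, h2, h3⟩ := key A hA hcA _ hb1 hbn _ rfl
    exact ⟨_, h1, h2, h3, by rw [h0, det_map_eq_zero hpos hc h2.posSemidef h0]⟩
  have hηc : (η c).PosDef := (hpos c hc.posSemidef).posDef_iff_det_ne_zero.2 h0
  obtain ⟨A, B, l, μ, ξ, hA, hB, hcA, hcB, hbA, hbB, hξ, hds⟩ :=
    exists_doublyStochastic_scaling hpos hc hηc hb.1 (hpos b hb).1 hmin
  have hr := hrank A hA l
  have hr' := hrank B hB μ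
  rw [← hbA] at hr
  rw [← hbB] at hr'
  have hl : ∀ i, 0 ≤ l i := hl0 A hA l (hbA ▸ hb)
  set S := Finset.univ.filter fun i => l i ≠ 0 with hS
  set T := Finset.univ.filter fun i => μ i ≠ 0 with hT
  rw [hr] at hb1 hbn
  rw [hr, hr'] at hηb
  have hξl : ξ (diagonal fun i => (l i : ℂ)) = diagonal fun i => (μ i : ℂ) := by
    have h1 := hξ (diagonal fun i => (l i : ℂ))
    rw [← hbA, hbB] at h1
    have hBs : IsUnit Bᴴ := hB.star
    exact (hB.mul_left_cancel (hBs.mul_right_cancel h1)).symm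
  have hST : ∀ j ∉ T, ∀ i ∈ S, diagWeight ξ j i = 0 := by
    intro j hj i hi
    have hμj : μ j = 0 := by simpa [hT] using hj
    have hli : l i ≠ 0 := by simpa [hS] using hi
    have h1 := re_map_diagonal_apply ξ l j
    rw [hξl, diagonal_apply_eq, hμj, Complex.ofReal_zero, Complex.zero_re] at h1
    have h2 := (Finset.sum_eq_zero_iff_of_nonneg
      (fun i _ => mul_nonneg (hds.diagWeight_nonneg j i) (hl i))).1 h1.symm i (Finset.mem_univ i)
    exact (mul_eq_zero.1 h2).resolve_right hli
  obtain ⟨hcard, hP⟩ := hds.map_coordProj_eq hST hηb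
  obtain ⟨h1, h2, h3⟩ := key A hA hcA S hb1 hbn _ rfl
  refine ⟨_, h1, h2, h3, ?_⟩
  rw [hξ, diagonal_ite_eq, map_add, map_smul, map_smul, map_sub, hP, hds.map_one, ← diagonal_ite_eq,
    det_mul_diagonal_mul_conjTranspose, ← hcB, ← hcard, prod_ite_mem_eq_one]
  simp

end Nonuniqueness

section LowerBound

variable {n : Type*} [Fintype n]

/-- The quadratic form of `M` dominates `δ` times the squared norm on some subspace of dimension
greater than `k`. -/
def HasLargeSubspace (M : Matrix n n ℂ) (k : ℕ) (δ : ℝ) : Prop :=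
  ∃ W : Submodule ℂ (n → ℂ), k < Module.finrank ℂ W ∧
    ∀ y ∈ W, δ * (star y ⬝ᵥ y).re ≤ (star y ⬝ᵥ M *ᵥ y).re

theorem re_star_dotProduct_self (y : n → ℂ) : (star y ⬝ᵥ y).re = ∑ i, ‖y i‖ ^ 2 := by
  simp only [dotProduct, Pi.star_apply, Complex.star_def, Complex.conj_mul', Complex.re_sum]
  norm_cast

theorem re_star_dotProduct_self_nonneg (y : n → ℂ) : 0 ≤ (star y ⬝ᵥ y).re := by
  rw [re_star_dotProduct_self]
  positivity

theorem star_dotProduct_conj_mulVec (U X : Matrix n n ℂ) (y : n → ℂ) :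
    star y ⬝ᵥ (U * X * Uᴴ) *ᵥ y = star (Uᴴ *ᵥ y) ⬝ᵥ X *ᵥ (Uᴴ *ᵥ y) := by
  rw [star_mulVec, conjTranspose_conjTranspose, ← mulVec_mulVec, ← mulVec_mulVec,
    dotProduct_mulVec (star y) U]

theorem re_star_dotProduct_diagonal_mulVec [DecidableEq n] (μ : n → ℝ) (y : n → ℂ) :
    (star y ⬝ᵥ (diagonal fun i => (μ i : ℂ)) *ᵥ y).re = ∑ i, μ i * ‖y i‖ ^ 2 := by
  simp only [dotProduct, mulVec_diagonal, Pi.star_apply, Complex.star_def, Complex.re_sum]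
  refine Finset.sum_congr rfl fun i _ => ?_
  rw [mul_left_comm, Complex.conj_mul']
  norm_cast

theorem star_dotProduct_unitary_mulVec [DecidableEq n] {U : Matrix n n ℂ}
    (hU : U ∈ unitaryGroup n ℂ) (y : n → ℂ) :
    star (Uᴴ *ᵥ y) ⬝ᵥ (Uᴴ *ᵥ y) = star y ⬝ᵥ y := by
  have := star_dotProduct_conj_mulVec U 1 y
  rw [Matrix.mul_one, show U * Uᴴ = 1 from mem_unitaryGroup_iff.1 hU, one_mulVec, one_mulVec] at this
  exact this.symm

namespace HasLargeSubspace

theorem mono {M : Matrix n n ℂ} {k : ℕ} {δ δ' : ℝ} (h : HasLargeSubspace M k δ) (hδ : δ' ≤ δ) :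
    HasLargeSubspace M k δ' := by
  obtain ⟨W, hW, h⟩ := h
  exact ⟨W, hW, fun y hy =>
    (mul_le_mul_of_nonneg_right hδ (re_star_dotProduct_self_nonneg y)).trans (h y hy)⟩

theorem of_posSemidef_sub {M N : Matrix n n ℂ} {k : ℕ} {δ a : ℝ} (h : HasLargeSubspace M k δ)
    (ha : 0 ≤ a) (hN : (N - (a : ℂ) • M).PosSemidef) : HasLargeSubspace N k (a * δ) := by
  obtain ⟨W, hW, h⟩ := h
  refine ⟨W, hW, fun y hy => ?_⟩
  have h1 := (Complex.nonneg_iff.1 (hN.dotProduct_mulVec_nonneg y)).1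
  rw [sub_mulVec, smul_mulVec, dotProduct_sub, dotProduct_smul, Complex.sub_re, smul_eq_mul,
    Complex.re_ofReal_mul] at h1
  have h2 := mul_le_mul_of_nonneg_left (h y hy) ha
  linarith

theorem of_norm_sub_le {M N : Matrix n n ℂ} {k : ℕ} {δ ε : ℝ} (h : HasLargeSubspace M k δ)
    (hε : ∀ i j, ‖N i j - M i j‖ ≤ ε) :
    HasLargeSubspace N k (δ - ε * Fintype.card n) := by
  obtain ⟨W, hW, h⟩ := h
  refine ⟨W, hW, fun y hy => ?_⟩
  have h1 : ‖star y ⬝ᵥ (N - M) *ᵥ y‖ ≤ ε * (∑ i, ‖y i‖) ^ 2 := by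
    calc ‖star y ⬝ᵥ (N - M) *ᵥ y‖ ≤ ∑ i, ∑ j, ‖y i‖ * (ε * ‖y j‖) := by
          rw [dotProduct]
          refine (norm_sum_le _ _).trans (Finset.sum_le_sum fun i _ => ?_)
          rw [← Finset.mul_sum, norm_mul, Pi.star_apply, norm_star]
          refine mul_le_mul_of_nonneg_left ?_ (norm_nonneg _)
          refine (norm_sum_le _ _).trans (Finset.sum_le_sum fun j _ => ?_)
          rw [norm_mul]
          exact mul_le_mul_of_nonneg_right (hε i j) (norm_nonneg _)
      _ = ε * (∑ i, ‖y i‖) ^ 2 := by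
          rw [pow_two, Finset.sum_mul_sum, Finset.mul_sum]
          refine Finset.sum_congr rfl fun i _ => ?_
          rw [Finset.mul_sum]
          exact Finset.sum_congr rfl fun j _ => by ring
  have h2 : (∑ i, ‖y i‖) ^ 2 ≤ Fintype.card n * ∑ i, ‖y i‖ ^ 2 := by
    simpa using sq_sum_le_card_mul_sum_sq (s := Finset.univ) (f := fun i => ‖y i‖)
  rcases isEmpty_or_nonempty n with hn | ⟨⟨i₀⟩⟩
  · simp [dotProduct]
  have hε0 : 0 ≤ ε := (norm_nonneg _).trans (hε i₀ i₀)
  have h3 := (Complex.abs_re_le_norm _).trans h1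
  have h4 := neg_le_of_abs_le h3
  have h5 := h y hy
  rw [sub_mulVec, dotProduct_sub, Complex.sub_re] at h4
  rw [re_star_dotProduct_self] at h5 ⊢
  have h6 := mul_le_mul_of_nonneg_left h2 hε0
  linarith

/-- A positive semidefinite matrix of rank greater than `k` is bounded below on a subspace of
dimension greater than `k`. -/
theorem of_lt_rank [DecidableEq n] {M : Matrix n n ℂ} (hM : M.PosSemidef) {k : ℕ} (hk : k < M.rank) :
    ∃ δ, 0 < δ ∧ HasLargeSubspace M k δ := by
  obtain ⟨U, hU, μ, h⟩ := exists_unitary_mul_diagonal_mul hM.1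
  have hUu : IsUnit U := (Unitary.toUnits ⟨U, hU⟩).isUnit
  have hμ : ∀ i, 0 ≤ μ i := by
    rw [h, posSemidef_mul_mul_conjTranspose_iff hUu, posSemidef_diagonal_iff] at hM
    exact fun i => by exact_mod_cast hM i
  have hrank : M.rank = Fintype.card {i // μ i ≠ 0} := by
    classical
    rw [h, rank_mul_mul_conjTranspose_of_isUnit hUu, rank_diagonal]
    simp
  obtain ⟨δ, hδ, hδμ⟩ : ∃ δ, 0 < δ ∧ ∀ i, μ i ≠ 0 → δ ≤ μ i := by
    have hfin : ∃ δ, 0 < δ ∧ ∀ x : {i // μ i ≠ 0}, δ ≤ μ x := by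
      rcases isEmpty_or_nonempty {i // μ i ≠ 0} with he | he
      · exact ⟨1, one_pos, fun x => he.elim x⟩
      · obtain ⟨x, hx⟩ := Finite.exists_min fun x : {i // μ i ≠ 0} => μ x
        exact ⟨μ x, (hμ x).lt_of_ne' x.2, hx⟩
    obtain ⟨δ, hδ, h⟩ := hfin
    exact ⟨δ, hδ, fun i hi => h ⟨i, hi⟩⟩
  let f : (n → ℂ) →ₗ[ℂ] ({i // μ i = 0} → ℂ) :=
    (LinearMap.funLeft ℂ ℂ Subtype.val).comp (Uᴴ).mulVecLin
  refine ⟨δ, hδ, LinearMap.ker f, ?_, fun y hy => ?_⟩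
  · have h1 := LinearMap.finrank_range_add_finrank_ker f
    have h2 := (LinearMap.range f).finrank_le
    rw [Module.finrank_fintype_fun_eq_card] at h1 h2
    have h3 := Fintype.card_subtype_compl fun i => μ i = 0
    have h4 := Fintype.card_subtype_le fun i => μ i = 0
    have h5 : Fintype.card {i // μ i ≠ 0} = Fintype.card {i // ¬ μ i = 0} := rfl
    omega
  · rw [h, star_dotProduct_conj_mulVec, ← star_dotProduct_unitary_mulVec hU,
      re_star_dotProduct_diagonal_mulVec, re_star_dotProduct_self, Finset.mul_sum]
    refine Finset.sum_le_sum fun i _ => ?_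
    by_cases hi : μ i = 0
    · have : (Uᴴ *ᵥ y) i = 0 := congrFun (LinearMap.mem_ker.1 hy) ⟨i, hi⟩
      simp [this]
    · exact mul_le_mul_of_nonneg_right (hδμ i hi) (by positivity)

/-- The minimax principle. -/
theorem le_eigenvalue {m : ℕ} {U : Matrix (Fin m) (Fin m) ℂ} (hU : U ∈ unitaryGroup (Fin m) ℂ)
    {μ : Fin m → ℝ} (hμ : Monotone μ) {j : Fin m} {δ : ℝ}
    (h : HasLargeSubspace (U * diagonal (fun i => (μ i : ℂ)) * Uᴴ) (Finset.Ioi j).card δ) :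
    δ ≤ μ j := by
  obtain ⟨W, hW, h⟩ := h
  let f : W →ₗ[ℂ] (Finset.Ioi j → ℂ) :=
    ((LinearMap.funLeft ℂ ℂ Subtype.val).comp (Uᴴ).mulVecLin).comp W.subtype
  have hker : LinearMap.ker f ≠ ⊥ := by
    refine LinearMap.ker_ne_bot_of_finrank_lt ?_
    rw [Module.finrank_fintype_fun_eq_card, Fintype.card_coe]
    exact hW
  obtain ⟨⟨y, hyW⟩, hyf, hy0⟩ := Submodule.exists_mem_ne_zero_of_ne_bot hker
  have hz : ∀ i, j < i → (Uᴴ *ᵥ y) i = 0 := fun i hi =>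
    congrFun (LinearMap.mem_ker.1 hyf) ⟨i, Finset.mem_Ioi.2 hi⟩
  have h1 := h y hyW
  have h2 : 0 < (star y ⬝ᵥ y).re := by
    refine (re_star_dotProduct_self_nonneg y).lt_of_ne' fun h0 => hy0 ?_
    rw [re_star_dotProduct_self, Finset.sum_eq_zero_iff_of_nonneg fun _ _ => by positivity] at h0
    ext i
    simpa using h0 i (Finset.mem_univ i)
  refine le_of_mul_le_mul_right (h1.trans ?_) h2
  rw [star_dotProduct_conj_mulVec, ← star_dotProduct_unitary_mulVec hU,
    re_star_dotProduct_diagonal_mulVec, re_star_dotProduct_self, Finset.mul_sum]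
  refine Finset.sum_le_sum fun i _ => ?_
  rcases le_or_gt i j with hij | hij
  · exact mul_le_mul_of_nonneg_right (hμ hij) (by positivity)
  · simp [hz i hij]

end HasLargeSubspace

theorem isCompact_of_isClosed_of_norm_apply_le {n : Type*} [Fintype n] {s : Set (Matrix n n ℂ)}
    (hs : IsClosed s) (R : ℝ) (hR : ∀ M ∈ s, ∀ i j, ‖M i j‖ ≤ R) : IsCompact s := by
  refine IsCompact.of_isClosed_subset (s := Set.univ.pi fun _ => Set.univ.pi fun _ =>
    Metric.closedBall (0 : ℂ) R) (isCompact_univ_pi fun _ => isCompact_univ_pi fun _ =>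
      isCompact_closedBall 0 R) hs fun M hM => ?_
  simpa using hR M hM

theorem isCompact_unitaryGroup [DecidableEq n] : IsCompact (unitaryGroup n ℂ : Set (Matrix n n ℂ)) := by
  refine isCompact_of_isClosed_of_norm_apply_le ?_ 1 fun U hU i j =>
    entry_norm_bound_of_unitary hU i j
  have : (unitaryGroup n ℂ : Set (Matrix n n ℂ)) = {U | U * star U = 1} := by
    ext U
    exact mem_unitaryGroup_iff
  rw [this]
  exact isClosed_eq (by fun_prop) continuous_const

theorem continuous_linearMap_matrix (η : Matrix n n ℂ →ₗ[ℂ] Matrix n n ℂ) : Continuous η :=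
  η.continuous_of_finiteDimensional

theorem isClosed_setOf_posSemidef : IsClosed {M : Matrix n n ℂ | M.PosSemidef} := by
  simp only [posSemidef_iff_dotProduct_mulVec, Set.ofPred_and, Set.ofPred_forall]
  refine (isClosed_eq (by fun_prop) continuous_id).inter (isClosed_iInter fun x => ?_)
  exact isClosed_le continuous_const (by fun_prop)

end LowerBound

section Existence

variable {m : ℕ}

theorem exists_uniform_hasLargeSubspace {n : Type*} [Fintype n] [DecidableEq n]
    {η : Matrix n n ℂ →ₗ[ℂ] Matrix n n ℂ}
    (hpos : ∀ x : Matrix n n ℂ, x.PosSemidef → (η x).PosSemidef)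
    (hind : ∀ b : Matrix n n ℂ, b.PosSemidef → 1 ≤ b.rank → b.rank < Fintype.card n →
      b.rank < (η b).rank)
    {S : Finset n} (hS1 : 1 ≤ S.card) (hSn : S.card < Fintype.card n) :
    ∃ δ, 0 < δ ∧ ∀ U ∈ unitaryGroup n ℂ,
      HasLargeSubspace (η (U * coordProj S * Uᴴ)) S.card δ := by
  have hcont : Continuous fun U : Matrix n n ℂ => η (U * coordProj S * Uᴴ) :=
    (continuous_linearMap_matrix η).comp (by fun_prop)
  refine isCompact_unitaryGroup.induction_on
    (p := fun s => ∃ δ, 0 < δ ∧ ∀ U ∈ s, HasLargeSubspace (η (U * coordProj S * Uᴴ)) S.card δ)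
    ⟨1, one_pos, fun U hU => hU.elim⟩ ?_ ?_ ?_
  · rintro s t hst ⟨δ, hδ, h⟩
    exact ⟨δ, hδ, fun U hU => h U (hst hU)⟩
  · rintro s t ⟨δ, hδ, h⟩ ⟨δ', hδ', h'⟩
    refine ⟨min δ δ', lt_min hδ hδ', fun U hU => ?_⟩
    rcases hU with hU | hU
    · exact (h U hU).mono (min_le_left _ _)
    · exact (h' U hU).mono (min_le_right _ _)
  · intro U hU
    have hUu : IsUnit U := (Unitary.toUnits ⟨U, hU⟩).isUnit
    have hP := (posSemidef_coordProj S).mul_mul_conjTranspose_same U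
    have hr : (U * coordProj S * Uᴴ).rank = S.card := by
      rw [rank_mul_mul_conjTranspose_of_isUnit hUu, rank_coordProj]
    have hlt := hind _ hP (hr ▸ hS1) (hr ▸ hSn)
    rw [hr] at hlt
    obtain ⟨δ, hδ, h⟩ := HasLargeSubspace.of_lt_rank (hpos _ hP) hlt
    have hn : (0 : ℝ) < Fintype.card n := by
      exact_mod_cast (Nat.zero_le _).trans_lt hSn
    set ε := δ / 2 / Fintype.card n with hε
    have hεpos : 0 < ε := by positivity
    refine ⟨{V | ∀ i j, ‖η (V * coordProj S * Vᴴ) i j - η (U * coordProj S * Uᴴ) i j‖ ≤ ε},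
      mem_nhdsWithin_of_mem_nhds ?_, δ / 2, half_pos hδ, fun V hV => ?_⟩
    · refine Filter.eventually_all.2 fun i => Filter.eventually_all.2 fun j => ?_
      have hc : Continuous fun V : Matrix n n ℂ =>
          ‖η (V * coordProj S * Vᴴ) i j - η (U * coordProj S * Uᴴ) i j‖ :=
        ((hcont.matrix_elem i j).sub continuous_const).norm
      have := hc.tendsto U
      simp only [sub_self, norm_zero] at this
      exact (this.eventually (gt_mem_nhds hεpos)).mono fun _ h => h.le
    · refine (h.of_norm_sub_le hV).mono (le_of_eq ?_)
      rw [hε, div_mul_cancel₀ _ hn.ne']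
      ring

theorem exists_norm_apply_le {η : Matrix (Fin (m + 2)) (Fin (m + 2)) ℂ →ₗ[ℂ]
      Matrix (Fin (m + 2)) (Fin (m + 2)) ℂ}
    (hpos : ∀ x, x.PosSemidef → (η x).PosSemidef)
    (hind : ∀ b, b.PosSemidef → 1 ≤ b.rank → b.rank < Fintype.card (Fin (m + 2)) →
      b.rank < (η b).rank) :
    ∃ K : ℝ, 0 ≤ K ∧ ∀ b, b.PosDef → b.det = 1 → ∀ i j, ‖b i j‖ ≤ K * (η b).det.re := by
  have hδ : ∀ k : Fin (m + 1), ∃ δ, 0 < δ ∧ ∀ U ∈ unitaryGroup (Fin (m + 2)) ℂ,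
      HasLargeSubspace (η (U * coordProj (Finset.Ioi k.castSucc) * Uᴴ))
        (Finset.Ioi k.castSucc).card δ := by
    intro k
    refine exists_uniform_hasLargeSubspace hpos hind ?_ ?_ <;>
    · rw [Fin.card_Ioi]
      simp
      omega
  choose δ' hδ' hlarge' using hδ
  obtain ⟨k₀, hk₀⟩ := Finite.exists_min δ'
  obtain ⟨δ, hδ, hlarge⟩ : ∃ δ, 0 < δ ∧ ∀ k : Fin (m + 1), ∀ U ∈ unitaryGroup (Fin (m + 2)) ℂ,
      HasLargeSubspace (η (U * coordProj (Finset.Ioi k.castSucc) * Uᴴ))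
        (Finset.Ioi k.castSucc).card δ :=
    ⟨δ' k₀, hδ' k₀, fun k U hU => (hlarge' k U hU).mono (hk₀ k)⟩
  refine ⟨(m + 2) / δ ^ (m + 2), by positivity, fun b hb hb1 i j => ?_⟩
  obtain ⟨U, hU, l, hlm, hbU⟩ := exists_unitary_mul_diagonal_mul_monotone hb.1
  obtain ⟨V, hV, μ, hμm, hbV⟩ :=
    exists_unitary_mul_diagonal_mul_monotone (hpos b hb.posSemidef).1
  have hUu : IsUnit U := (Unitary.toUnits ⟨U, hU⟩).isUnit
  have hUU : U * Uᴴ = 1 := mem_unitaryGroup_iff.1 hU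
  have hVV : V * Vᴴ = 1 := mem_unitaryGroup_iff.1 hV
  have hl : ∀ i, 0 < l i := by
    rw [hbU, posDef_mul_mul_conjTranspose_iff hUu, posDef_diagonal_iff] at hb
    exact fun i => by exact_mod_cast hb i
  have hl1 : ∏ i, l i = 1 := by
    rw [hbU, det_mul_diagonal_mul_conjTranspose, hUU, det_one, one_mul] at hb1
    exact_mod_cast hb1
  have hμ1 : (η b).det.re = ∏ i, μ i := by
    rw [hbV, det_mul_diagonal_mul_conjTranspose, hVV, det_one, one_mul, Complex.ofReal_re]
  have hμl : ∀ k : Fin (m + 1), l k.succ * δ ≤ μ k.castSucc := by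
    intro k
    refine HasLargeSubspace.le_eigenvalue hV hμm (j := k.castSucc) ?_
    rw [← hbV]
    refine (hlarge k U hU).of_posSemidef_sub (hl _).le ?_
    rw [← map_smul, ← map_sub]
    refine hpos _ ?_
    have : b - (l k.succ : ℂ) • (U * coordProj (Finset.Ioi k.castSucc) * Uᴴ) =
        U * diagonal (fun i => ((l i - l k.succ * (if i ∈ Finset.Ioi k.castSucc then 1 else 0) :
          ℝ) : ℂ)) * Uᴴ := by
      have : diagonal (fun i => ((l i - l k.succ * (if i ∈ Finset.Ioi k.castSucc then 1 else 0) :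
          ℝ) : ℂ)) = diagonal (fun i => (l i : ℂ)) -
            (l k.succ : ℂ) • coordProj (Finset.Ioi k.castSucc) := by
        rw [coordProj, ← diagonal_smul, diagonal_sub]
        congr 1
        ext i
        simp only [Complex.ofReal_sub, Complex.ofReal_mul]
        rfl
      rw [this, Matrix.mul_sub, Matrix.sub_mul, ← hbU, Matrix.mul_smul, Matrix.smul_mul]
    rw [this, posSemidef_mul_mul_conjTranspose_iff hUu, posSemidef_diagonal_iff]
    intro i
    have : 0 ≤ l i - l k.succ * (if i ∈ Finset.Ioi k.castSucc then 1 else 0) := by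
      split_ifs with hi
      · have : k.succ ≤ i := Fin.castSucc_lt_iff_succ_le.1 (Finset.mem_Ioi.1 hi)
        linarith [hlm this]
      · linarith [(hl i).le]
    exact_mod_cast this
  set L := l (Fin.last (m + 1)) with hL
  have hlast : L * δ ≤ μ (Fin.last (m + 1)) :=
    (hμl (Fin.last m)).trans (hμm (Fin.le_last _))
  have hl0 : l 0 ≤ 1 := by
    by_contra! hgt
    have : 1 < ∏ i, l i := by
      simpa using Finset.prod_lt_prod_of_nonempty (s := Finset.univ) (f := fun _ => (1 : ℝ))
        (g := l) (fun _ _ => one_pos) (fun i _ => hgt.trans_le (hlm (Fin.zero_le i)))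
        Finset.univ_nonempty
    exact this.ne' hl1
  have hprod : L * δ ^ (m + 2) ≤ (η b).det.re := by
    rw [hμ1, Fin.prod_univ_castSucc]
    have h1 : ∏ k : Fin (m + 1), (l k.succ * δ) ≤ ∏ k : Fin (m + 1), μ k.castSucc :=
      Finset.prod_le_prod (fun k _ => (mul_pos (hl _) hδ).le) fun k _ => hμl k
    have h2 : 1 ≤ ∏ k : Fin (m + 1), l k.succ := by
      rw [Fin.prod_univ_succ] at hl1
      rw [← hl1]
      exact mul_le_of_le_one_left (Finset.prod_nonneg fun k _ => (hl _).le) hl0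
    rw [Finset.prod_mul_distrib, Finset.prod_const, Finset.card_univ, Fintype.card_fin] at h1
    have hLδ : 0 ≤ L * δ := (mul_pos (hl _) hδ).le
    have hμ0 : 0 ≤ ∏ k : Fin (m + 1), μ k.castSucc :=
      Finset.prod_nonneg fun k _ => (mul_pos (hl _) hδ).le.trans (hμl k)
    calc L * δ ^ (m + 2) = 1 * δ ^ (m + 1) * (L * δ) := by ring
      _ ≤ (∏ k : Fin (m + 1), l k.succ) * δ ^ (m + 1) * (L * δ) := by gcongr
      _ ≤ (∏ k : Fin (m + 1), μ k.castSucc) * μ (Fin.last (m + 1)) := by gcongr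
  have hbij : ‖b i j‖ ≤ (m + 2) * L := by
    rw [hbU, Matrix.mul_apply]
    refine (norm_sum_le _ _).trans ?_
    calc ∑ k, ‖(U * diagonal fun i => (l i : ℂ)) i k * Uᴴ k j‖ ≤ ∑ k : Fin (m + 2), L := by
          refine Finset.sum_le_sum fun k _ => ?_
          rw [mul_diagonal, conjTranspose_apply, norm_mul, norm_mul, norm_star, Complex.norm_real,
            Real.norm_of_nonneg (hl k).le]
          have h1 := entry_norm_bound_of_unitary hU i k
          have h2 := entry_norm_bound_of_unitary hU j k
          calc ‖U i k‖ * l k * ‖U j k‖ ≤ 1 * L * 1 := by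
                gcongr
                · exact mul_nonneg zero_le_one (hl _).le
                · exact (hl _).le
                · exact hlm (Fin.le_last k)
            _ = L := by ring
      _ = (m + 2) * L := by simp
  refine hbij.trans ?_
  rw [div_mul_eq_mul_div, le_div_iff₀ (by positivity), mul_assoc]
  gcongr

theorem exists_minimizer {η : Matrix (Fin (m + 2)) (Fin (m + 2)) ℂ →ₗ[ℂ]
      Matrix (Fin (m + 2)) (Fin (m + 2)) ℂ}
    (hpos : ∀ x, x.PosSemidef → (η x).PosSemidef)
    (hind : ∀ b, b.PosSemidef → 1 ≤ b.rank → b.rank < Fintype.card (Fin (m + 2)) →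
      b.rank < (η b).rank) :
    ∃ c, c.PosDef ∧ c.det = 1 ∧ 0 < (η c).det.re ∧
      ∀ b, b.PosDef → b.det = 1 → (η c).det.re ≤ (η b).det.re := by
  obtain ⟨K, hK, hbound⟩ := exists_norm_apply_le hpos hind
  have hcont : Continuous fun b => (η b).det.re :=
    Complex.continuous_re.comp (continuous_linearMap_matrix η).matrix_det
  set s : Set (Matrix (Fin (m + 2)) (Fin (m + 2)) ℂ) :=
    {b | b.PosSemidef ∧ b.det = 1 ∧ (η b).det.re ≤ (η 1).det.re} with hs
  have hpd : ∀ b : Matrix (Fin (m + 2)) (Fin (m + 2)) ℂ, b.PosSemidef → b.det = 1 → b.PosDef :=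
    fun b hb hb1 => hb.posDef_iff_det_ne_zero.2 (by rw [hb1]; exact one_ne_zero)
  have hclosed : IsClosed s :=
    isClosed_setOf_posSemidef.inter
      ((isClosed_eq continuous_id.matrix_det continuous_const).inter
        (isClosed_le hcont continuous_const))
  have hcomp : IsCompact s :=
    isCompact_of_isClosed_of_norm_apply_le hclosed (K * (η 1).det.re) fun b hb i j =>
      (hbound b (hpd b hb.1 hb.2.1) hb.2.1 i j).trans (mul_le_mul_of_nonneg_left hb.2.2 hK)
  have h1s : (1 : Matrix (Fin (m + 2)) (Fin (m + 2)) ℂ) ∈ s :=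
    ⟨PosSemidef.one, det_one, le_rfl⟩
  obtain ⟨c, hc, hmin⟩ := hcomp.exists_isMinOn ⟨1, h1s⟩ hcont.continuousOn
  have hcpd := hpd c hc.1 hc.2.1
  refine ⟨c, hcpd, hc.2.1, ?_, fun b hb hb1 => ?_⟩
  · refine ((Complex.nonneg_iff.1 (hpos c hc.1).det_nonneg).1).lt_of_ne' fun h0 => ?_
    have hc0 : c = 0 := by
      ext i j
      have := hbound c hcpd hc.2.1 i j
      rw [h0, mul_zero] at this
      exact norm_le_zero_iff.1 this
    have := hc.2.1
    rw [hc0, det_zero] at this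
    exact zero_ne_one this
  · rcases le_total (η b).det.re (η 1).det.re with h | h
    · exact hmin (show b ∈ s from ⟨hb.posSemidef, hb1, h⟩)
    · exact hc.2.2.trans h

/-- The minimising property for matrices of determinant one, in homogeneous form. -/
theorem det_mul_det_le_of_minimal {n : Type*} [Fintype n] [DecidableEq n] [Nonempty n]
    {η : Matrix n n ℂ →ₗ[ℂ] Matrix n n ℂ} {c : Matrix n n ℂ} (hc : c.det = 1)
    (hmin : ∀ b : Matrix n n ℂ, b.PosDef → b.det = 1 → (η c).det.re ≤ (η b).det.re)
    {x : Matrix n n ℂ} (hx : x.PosDef) :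
    (η c).det.re * x.det.re ≤ c.det.re * (η x).det.re := by
  obtain ⟨hd, hd'⟩ := Complex.pos_iff.1 hx.det_pos
  set d := x.det.re
  have hxd : x.det = (d : ℂ) := Complex.ext rfl (by simpa using hd'.symm)
  set s : ℝ := d⁻¹ ^ ((Fintype.card n : ℝ)⁻¹)
  have hs : s ^ Fintype.card n = d⁻¹ :=
    Real.rpow_inv_natCast_pow (inv_nonneg.2 hd.le) Fintype.card_ne_zero
  have hs0 : 0 < s := Real.rpow_pos_of_pos (inv_pos.2 hd) _
  have h1 := hmin ((s : ℂ) • x) (hx.smul (by exact_mod_cast hs0)) (by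
    rw [det_smul, ← Complex.ofReal_pow, hs, hxd, ← Complex.ofReal_mul, inv_mul_cancel₀ hd.ne',
      Complex.ofReal_one])
  rw [map_smul, det_smul, ← Complex.ofReal_pow, hs, Complex.re_ofReal_mul] at h1
  rw [hc, Complex.one_re, one_mul]
  calc (η c).det.re * d ≤ d⁻¹ * (η x).det.re * d := by gcongr
    _ = (η x).det.re := by field_simp

end Existence

theorem cap_le {m : ℕ} {η : Matrix (Fin m) (Fin m) ℂ → Matrix (Fin m) (Fin m) ℂ}
    (hpos : ∀ b : Matrix (Fin m) (Fin m) ℂ, b.PosSemidef → (η b).PosSemidef)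
    {b : Matrix (Fin m) (Fin m) ℂ} (hb : b.PosDef) (hb1 : b.det = 1) :
    cap η ≤ (η b).det.re := by
  refine csInf_le ⟨0, ?_⟩ ⟨b, hb, hb1, rfl⟩
  rintro _ ⟨x, hx, -, rfl⟩
  exact (Complex.nonneg_iff.1 (hpos x hx.posSemidef).det_nonneg).1

theorem det_re_eq_cap_iff {m : ℕ} {η : Matrix (Fin m) (Fin m) ℂ → Matrix (Fin m) (Fin m) ℂ}
    (hpos : ∀ b : Matrix (Fin m) (Fin m) ℂ, b.PosSemidef → (η b).PosSemidef)
    {c : Matrix (Fin m) (Fin m) ℂ} (hc : c.PosDef) (hc1 : c.det = 1) :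
    (η c).det.re = cap η ↔
      ∀ b : Matrix (Fin m) (Fin m) ℂ, b.PosDef → b.det = 1 → (η c).det.re ≤ (η b).det.re := by
  refine ⟨fun h b hb hb1 => h ▸ cap_le hpos hb hb1, fun h => le_antisymm ?_ (cap_le hpos hc hc1)⟩
  refine le_csInf ⟨_, c, hc, hc1, rfl⟩ ?_
  rintro _ ⟨x, hx, hx1, rfl⟩
  exact h x hx hx1

theorem Matrix.PosSemidef.det_eq_ofReal_re {n : Type*} [Fintype n] [DecidableEq n]
    {M : Matrix n n ℂ} (hM : M.PosSemidef) : M.det = (M.det.re : ℂ) :=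
  Complex.ext rfl (by simpa using (Complex.nonneg_iff.1 hM.det_nonneg).2.symm)

theorem stmt4 (m : ℕ)
    (η : Matrix (Fin m) (Fin m) ℂ →ₗ[ℂ] Matrix (Fin m) (Fin m) ℂ)
    (hpos : ∀ b : Matrix (Fin m) (Fin m) ℂ, b.PosSemidef → (η b).PosSemidef) :
    (∀ b : Matrix (Fin m) (Fin m) ℂ, b.PosSemidef →
        1 ≤ b.rank → b.rank < m → b.rank < (η b).rank)
      ↔ (∃! c : Matrix (Fin m) (Fin m) ℂ,
          c.PosDef ∧ c.det = 1 ∧ ((η c).det).re = cap (⇑η)) := by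
  constructor
  · intro hind
    rcases Nat.lt_or_ge m 2 with hm | hm
    · have hone : ∀ b : Matrix (Fin m) (Fin m) ℂ, b.det = 1 → b = 1 := by
        intro b hb
        interval_cases m
        · exact Subsingleton.elim _ _
        · rw [det_fin_one] at hb
          ext i j
          rw [Subsingleton.elim i 0, Subsingleton.elim j 0, hb, one_apply_eq]
      refine ⟨1, ⟨PosDef.one, det_one, ?_⟩, fun b hb => hone b hb.2.1⟩
      rw [det_re_eq_cap_iff hpos PosDef.one det_one]
      intro b _ hb1
      rw [hone b hb1]
    · obtain ⟨m, rfl⟩ := Nat.exists_eq_add_of_le' hm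
      have hind' : ∀ b : Matrix (Fin (m + 2)) (Fin (m + 2)) ℂ, b.PosSemidef → 1 ≤ b.rank →
          b.rank < Fintype.card (Fin (m + 2)) → b.rank < (η b).rank := by
        simpa only [Fintype.card_fin] using hind
      obtain ⟨c, hc, hc1, hc0, hmin⟩ := exists_minimizer hpos hind'
      have hcap := (det_re_eq_cap_iff hpos hc hc1).2 hmin
      refine ⟨c, ⟨hc, hc1, hcap⟩, ?_⟩
      rintro b ⟨hb, hb1, hbcap⟩
      have hηc := hpos c hc.posSemidef
      refine minimizer_unique hpos hind' hc (hηc.posDef_iff_det_ne_zero.2 ?_) hb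
        (fun x hx => det_mul_det_le_of_minimal hc1 hmin hx) (hb1.trans hc1.symm) ?_
      · exact fun h => hc0.ne' (by rw [h, Complex.zero_re])
      · rw [(hpos b hb.posSemidef).det_eq_ofReal_re, hηc.det_eq_ofReal_re, hbcap, hcap]
  · rintro ⟨c, ⟨hc, hc1, hcap⟩, huniq⟩ b hb hb1 hbm
    by_contra! hle
    have : Nonempty (Fin m) := ⟨⟨0, by omega⟩⟩
    have hmin := (det_re_eq_cap_iff hpos hc hc1).1 hcap
    obtain ⟨c', hne, hc', hdet, hηdet⟩ := exists_ne_minimizer hpos hc hb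
      (fun x hx => det_mul_det_le_of_minimal hc1 hmin hx) hb1 (by simpa using hbm) hle
    exact hne (huniq c' ⟨hc', hdet.trans hc1, by rw [hηdet, hcap]⟩)
end

section
/- Let η : Mₘ(ℂ) → Mₘ(ℂ) be a completely positive map of the form η(b) = ∑_{i=1}^n aᵢ b aᵢ* with a₁,…,aₙ ∈ Mₘ(ℂ), and suppose cap(η) > 0. Suppose c ∈ Mₘ(ℂ) is a positive definite matrix and δ ∈ (0, 1/6] is such that cap(η) ≥ e^{−δ} · det(η(c))/det(c). Then η(c) is invertible and Tr((c · η*(η(c)^{−1}) − 1ₘ)²) ≤ 6δ, where η*(b) = ∑_{i=1}^n aᵢ* b aᵢ and Tr denotes the unnormalized trace on Mₘ(ℂ). -/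
open ComplexOrder Matrix

theorem sq_sub_one_le_of_sub_log_le {x : ℝ} (hx : 0 < x) (h : x - 1 - Real.log x ≤ 1 / 6) :
    (x - 1) ^ 2 ≤ 6 * (x - 1 - Real.log x) := by
  rcases le_total x 2 with hx2 | hx2
  · have hu : x ≤ Real.exp (x - 1 - (x - 1) ^ 2 / 6) := by
      obtain ⟨u, hu⟩ : ∃ u, u = x - 1 - (x - 1) ^ 2 / 6 := ⟨_, rfl⟩
      have h1 : u / 2 + 1 ≤ Real.exp (u / 2) := Real.add_one_le_exp _
      have h2 : 0 ≤ u / 2 + 1 := by nlinarith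
      have h3 : Real.exp u = Real.exp (u / 2) ^ 2 := by
        rw [← Real.exp_nat_mul]; congr 1; push_cast; ring
      rw [← hu, h3]
      have h4 : (u / 2 + 1) ^ 2 - x = (x - 1) ^ 2 * ((7 - x) ^ 2 / 144 - 1 / 6) := by
        rw [hu]; ring
      nlinarith [mul_nonneg (sq_nonneg (x - 1))
        (by nlinarith : (0 : ℝ) ≤ (7 - x) ^ 2 / 144 - 1 / 6), pow_le_pow_left₀ h2 h1 2]
    have := (Real.log_le_iff_le_exp hx).2 hu
    linarith
  · exfalso
    have h1 := Real.log_le_sub_one_of_pos (half_pos hx)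
    rw [Real.log_div hx.ne' two_ne_zero] at h1
    linarith [Real.log_two_lt_d9]

namespace Matrix

variable {ι : Type*} [Fintype ι] [DecidableEq ι]

theorem PosSemidef.det_re_le_one {A : Matrix ι ι ℂ} (hA : A.PosSemidef)
    (htr : A.trace.re ≤ Fintype.card ι) : A.det.re ≤ 1 := by
  have hdet : A.det.re = ∏ i, hA.1.eigenvalues i := by
    rw [hA.1.det_eq_prod_eigenvalues]
    simp only [Complex.coe_algebraMap, ← Complex.ofReal_prod, Complex.ofReal_re]
  have htr' : A.trace.re = ∑ i, hA.1.eigenvalues i := by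
    rw [hA.1.trace_eq_sum_eigenvalues]; simp
  calc A.det.re = ∏ i, hA.1.eigenvalues i := hdet
    _ ≤ ∏ i, Real.exp (hA.1.eigenvalues i - 1) :=
        Finset.prod_le_prod (fun i _ => hA.eigenvalues_nonneg i)
          fun i _ => by linarith [Real.add_one_le_exp (hA.1.eigenvalues i - 1)]
    _ = Real.exp (A.trace.re - Fintype.card ι) := by
        rw [← Real.exp_sum, htr']; simp
    _ ≤ 1 := Real.exp_le_one_iff.2 (by linarith)

theorem IsHermitian.trace_sub_one_sq {A : Matrix ι ι ℂ} (hA : A.IsHermitian) :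
    ((A - 1) ^ 2).trace = ((∑ i, (hA.eigenvalues i - 1) ^ 2 : ℝ) : ℂ) := by
  set U := hA.eigenvectorUnitary
  set d : Matrix ι ι ℂ := diagonal ((↑) ∘ hA.eigenvalues)
  have h1 : A - 1 = Unitary.conjStarAlgAut ℂ _ U (d - 1) := by
    rw [map_sub, map_one]; congr 1; exact hA.spectral_theorem
  have h2 : d - 1 = diagonal fun i => ((hA.eigenvalues i - 1 : ℝ) : ℂ) := by
    ext i j
    by_cases h : i = j <;> simp [d, h]
  rw [h1, ← map_pow, Unitary.conjStarAlgAut_apply, trace_mul_cycle, Unitary.coe_star_mul_self,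
    one_mul, h2, diagonal_pow, trace_diagonal]
  simp

theorem PosDef.exists_isUnit_mul_conjTranspose {A : Matrix ι ι ℂ} (hA : A.PosDef) :
    ∃ S : Matrix ι ι ℂ, IsUnit S ∧ A = S * Sᴴ := by
  open scoped MatrixOrder in
  obtain ⟨S, hS⟩ := CStarAlgebra.nonneg_iff_eq_mul_star_self.1 hA.posSemidef.nonneg
  refine ⟨S, ?_, hS⟩
  have := hA.isUnit
  rw [isUnit_iff_isUnit_det] at this ⊢
  rw [hS, det_mul] at this
  exact isUnit_of_mul_isUnit_left this

end Matrix

theorem cap_mul_det_le {m : ℕ} {η : Matrix (Fin m) (Fin m) ℂ → Matrix (Fin m) (Fin m) ℂ}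
    (hpos : ∀ b, b.PosDef → (η b).PosSemidef)
    (hsmul : ∀ (t : ℝ) b, η ((t : ℂ) • b) = (t : ℂ) • η b)
    {b : Matrix (Fin m) (Fin m) ℂ} (hb : b.PosDef) :
    cap η * b.det.re ≤ (η b).det.re := by
  have hle : ∀ b : Matrix (Fin m) (Fin m) ℂ, b.PosDef → b.det = 1 → cap η ≤ (η b).det.re :=
    fun b hb h1 => csInf_le
      ⟨0, by rintro _ ⟨b, hb, -, rfl⟩; exact (Complex.le_def.1 (hpos b hb).det_nonneg).1⟩
      ⟨b, hb, h1, rfl⟩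
  have hbd : 0 < b.det.re := (Complex.lt_def.1 hb.det_pos).1
  have hbr : b.det = (b.det.re : ℂ) := Complex.eq_re_of_ofReal_le hb.det_pos.le
  obtain ⟨t, ht, htm⟩ : ∃ t : ℝ, 0 < t ∧ t ^ m * b.det.re = 1 := by
    rcases eq_or_ne m 0 with rfl | hm
    · exact ⟨1, one_pos, by simp⟩
    · refine ⟨(b.det.re⁻¹) ^ (m⁻¹ : ℝ), by positivity, ?_⟩
      rw [Real.rpow_inv_natCast_pow (by positivity) hm, inv_mul_cancel₀ hbd.ne']
  have h := hle ((t : ℂ) • b) (hb.smul (by exact_mod_cast ht)) (by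
    rw [det_smul, hbr, Fintype.card_fin]; exact_mod_cast htm)
  rw [hsmul, det_smul, Fintype.card_fin, ← Complex.ofReal_pow, Complex.re_ofReal_mul] at h
  calc cap η * b.det.re ≤ t ^ m * (η b).det.re * b.det.re :=
        mul_le_mul_of_nonneg_right h hbd.le
    _ = (t ^ m * b.det.re) * (η b).det.re := by ring
    _ = (η b).det.re := by rw [htm, one_mul]

namespace Matrix

variable {ι : Type*} [Fintype ι] [DecidableEq ι]

theorem PosSemidef.trace_mul_inv_add_smul_one_re_le {A : Matrix ι ι ℂ} (hA : A.PosSemidef)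
    {ε : ℝ} (hε : 0 < ε) :
    (A * (A + (ε : ℂ) • 1)⁻¹).trace.re ≤ Fintype.card ι := by
  have hB : (A + (ε : ℂ) • (1 : Matrix ι ι ℂ)).PosDef :=
    PosDef.posSemidef_add hA (PosDef.one.smul (by exact_mod_cast hε))
  have h : A * (A + (ε : ℂ) • 1)⁻¹ = 1 - (ε : ℂ) • (A + (ε : ℂ) • 1)⁻¹ := by
    have hinv := mul_nonsing_inv _ ((isUnit_iff_isUnit_det _).1 hB.isUnit)
    rwa [add_mul, smul_mul_assoc, one_mul, ← eq_sub_iff_add_eq] at hinv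
  have h0 := (Complex.le_def.1 hB.inv.posSemidef.trace_nonneg).1
  rw [h, trace_sub, trace_smul, trace_one, smul_eq_mul, Complex.sub_re, Complex.re_ofReal_mul]
  simpa using mul_nonneg hε.le h0

theorem PosSemidef.trace_sub_one_sq_le {A : Matrix ι ι ℂ} (hA : A.PosSemidef)
    (htr : A.trace = Fintype.card ι) {δ : ℝ} (hδ : δ ≤ 1 / 6)
    (hdet : Real.exp (-δ) ≤ A.det.re) :
    ((A - 1) ^ 2).trace ≤ ((6 * δ : ℝ) : ℂ) := by
  set ev := hA.1.eigenvalues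
  have hdet' : A.det.re = ∏ i, ev i := by
    rw [hA.1.det_eq_prod_eigenvalues]
    simp only [Complex.coe_algebraMap, ← Complex.ofReal_prod, Complex.ofReal_re, ev]
  have hsum : ∑ i, ev i = Fintype.card ι := by
    have := congrArg Complex.re (hA.1.trace_eq_sum_eigenvalues.symm.trans htr)
    simpa [ev] using this
  have hprod : 0 < ∏ i, ev i := hdet' ▸ (Real.exp_pos _).trans_le hdet
  have hpos : ∀ i, 0 < ev i := fun i =>
    (hA.eigenvalues_nonneg i).lt_of_ne' fun h =>
      hprod.ne' (Finset.prod_eq_zero (Finset.mem_univ i) h)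
  have hlog : -δ ≤ ∑ i, Real.log (ev i) := by
    rw [← Real.log_prod fun i _ => (hpos i).ne', Real.le_log_iff_exp_le hprod, ← hdet']
    exact hdet
  have hle : ∑ i, (ev i - 1 - Real.log (ev i)) ≤ δ := by
    simp only [Finset.sum_sub_distrib, hsum, Finset.sum_const, Finset.card_univ, nsmul_eq_mul,
      mul_one]
    linarith
  have hnn : ∀ i, 0 ≤ ev i - 1 - Real.log (ev i) := fun i => by
    linarith [Real.log_le_sub_one_of_pos (hpos i)]
  rw [hA.1.trace_sub_one_sq, Complex.real_le_real]
  calc ∑ i, (ev i - 1) ^ 2 ≤ ∑ i, 6 * (ev i - 1 - Real.log (ev i)) :=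
        Finset.sum_le_sum fun i _ => sq_sub_one_le_of_sub_log_le (hpos i) <|
          (Finset.single_le_sum (fun j _ => hnn j) (Finset.mem_univ i)).trans (hle.trans hδ)
    _ ≤ 6 * δ := by rw [← Finset.mul_sum]; linarith

end Matrix

theorem stmt6 (m n : ℕ) (a : Fin n → Matrix (Fin m) (Fin m) ℂ)
    (η ηd : Matrix (Fin m) (Fin m) ℂ → Matrix (Fin m) (Fin m) ℂ)
    (hη : ∀ b, η b = ∑ i, a i * b * (a i)ᴴ)
    (hηd : ∀ b, ηd b = ∑ i, (a i)ᴴ * b * a i)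
    (hcap : 0 < cap η)
    (c : Matrix (Fin m) (Fin m) ℂ) (hc : c.PosDef)
    (δ : ℝ) (hδ0 : 0 < δ) (hδ1 : δ ≤ 1 / 6)
    (hineq : Real.exp (-δ) * (((η c).det).re / (c.det).re) ≤ cap η) :
    IsUnit (η c) ∧
    ((c * ηd ((η c)⁻¹) - 1) ^ 2).trace ≤ ((6 * δ : ℝ) : ℂ) := by
  have hpos : ∀ b, b.PosDef → (η b).PosSemidef := fun b hb => by
    rw [hη]
    exact posSemidef_sum _ fun i _ => hb.posSemidef.mul_mul_conjTranspose_same (a i)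
  have hsmul : ∀ (t : ℝ) b, η ((t : ℂ) • b) = (t : ℂ) • η b := fun t b => by
    simp only [hη, Finset.smul_sum, Matrix.mul_smul, Matrix.smul_mul]
  have hcapdet : ∀ b : Matrix (Fin m) (Fin m) ℂ, b.PosDef → cap η * b.det.re ≤ (η b).det.re :=
    fun b hb => cap_mul_det_le hpos hsmul hb
  have hdetre : ∀ {b : Matrix (Fin m) (Fin m) ℂ}, b.PosDef →
      0 < b.det.re ∧ b.det = (b.det.re : ℂ) := fun hb =>
    ⟨(Complex.lt_def.1 hb.det_pos).1, Complex.eq_re_of_ofReal_le hb.det_pos.le⟩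
  have hc0 := (hdetre hc).1
  have hDre : 0 < (η c).det.re := (mul_pos hcap hc0).trans_le (hcapdet c hc)
  have hD : (η c).PosDef := (hpos c hc).posDef_iff_det_ne_zero.2 fun h => by simp [h] at hDre
  refine ⟨hD.isUnit, ?_⟩
  have hdual : ∀ b, (ηd (η c)⁻¹ * b).trace = ((η c)⁻¹ * η b).trace := fun b => by
    simp only [hη b, hηd, Finset.sum_mul, Finset.mul_sum, trace_sum]
    refine Finset.sum_congr rfl fun i _ => ?_
    rw [Matrix.mul_assoc, Matrix.mul_assoc, Matrix.trace_mul_comm]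
    simp only [Matrix.mul_assoc]
  obtain ⟨S, hS, hcS⟩ := hc.exists_isUnit_mul_conjTranspose
  obtain ⟨T, -, hDT⟩ := hD.inv.exists_isUnit_mul_conjTranspose
  have hSdet := (isUnit_iff_isUnit_det _).1 hS
  set K := ηd (η c)⁻¹ with hK
  have hKpos : K.PosSemidef := by
    rw [hK, hηd]
    exact posSemidef_sum _ fun i _ => hD.inv.posSemidef.conjTranspose_mul_mul_same (a i)
  set M := Sᴴ * K * S with hM
  have hMpos : M.PosSemidef := hKpos.conjTranspose_mul_mul_same S
  have hMtr : M.trace = Fintype.card (Fin m) := by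
    rw [hM, Matrix.trace_mul_comm, ← Matrix.mul_assoc, ← hcS, Matrix.trace_mul_comm, hdual,
      nonsing_inv_mul _ ((isUnit_iff_isUnit_det _).1 hD.isUnit), trace_one]
  have hMdet : ∀ ε : ℝ, 0 < ε → Real.exp (-δ) ≤ (M + (ε : ℂ) • 1).det.re := fun ε hε => by
    have hB : (M + (ε : ℂ) • (1 : Matrix (Fin m) (Fin m) ℂ)).PosDef :=
      PosDef.posSemidef_add hMpos (PosDef.one.smul (by exact_mod_cast hε))
    set B := M + (ε : ℂ) • (1 : Matrix (Fin m) (Fin m) ℂ) with hBdef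
    set b := S * B⁻¹ * Sᴴ with hb
    have hbpos : b.PosDef :=
      hB.inv.mul_mul_conjTranspose_same (Matrix.vecMul_injective_of_isUnit hS)
    have hbdet : b.det.re * B.det.re = c.det.re := by
      have h : b.det * B.det = c.det := by
        have h1 : B⁻¹.det * B.det = 1 := by
          rw [← det_mul, nonsing_inv_mul _ ((isUnit_iff_isUnit_det _).1 hB.isUnit), det_one]
        rw [hb, hcS, det_mul, det_mul, det_mul]
        linear_combination S.det * Sᴴ.det * h1
      rw [← h, (hdetre hB).2, Complex.re_mul_ofReal, Complex.ofReal_re]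
    have htr : (Tᴴ * η b * T).trace = (M * B⁻¹).trace := by
      rw [Matrix.trace_mul_comm, ← Matrix.mul_assoc, ← hDT, ← hdual, hb, hM,
        ← Matrix.mul_assoc, Matrix.trace_mul_comm]
      simp only [Matrix.mul_assoc]
    have h1 : (Tᴴ * η b * T).det.re ≤ 1 :=
      ((hpos b hbpos).conjTranspose_mul_mul_same T).det_re_le_one <| by
        rw [htr]; exact hMpos.trace_mul_inv_add_smul_one_re_le hε
    have h2 : (η b).det.re = (Tᴴ * η b * T).det.re * (η c).det.re := by
      have h : (η b).det = (Tᴴ * η b * T).det * (η c).det := by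
        have h1 : T.det * Tᴴ.det * (η c).det = 1 := by
          rw [← det_mul, ← hDT, ← det_mul,
            nonsing_inv_mul _ ((isUnit_iff_isUnit_det _).1 hD.isUnit), det_one]
        rw [det_mul, det_mul]
        linear_combination -(η b).det * h1
      rw [h, (hdetre hD).2, Complex.re_mul_ofReal, Complex.ofReal_re]
    have h3 : cap η * b.det.re ≤ (η c).det.re :=
      (hcapdet b hbpos).trans <| h2 ▸ mul_le_of_le_one_left hDre.le h1
    have hb0 := (hdetre hbpos).1
    have hB0 := (hdetre hB).1
    have h4 : Real.exp (-δ) * ((η c).det.re / c.det.re) * b.det.re ≤ (η c).det.re :=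
      (mul_le_mul_of_nonneg_right hineq hb0.le).trans h3
    rw [← hbdet] at h4
    have h5 : Real.exp (-δ) * ((η c).det.re / (b.det.re * B.det.re)) * b.det.re
        = (Real.exp (-δ) / B.det.re) * (η c).det.re := by
      field_simp
    rw [h5] at h4
    exact (div_le_one hB0).1 ((mul_le_iff_le_one_left hDre).1 h4)
  have hlim : Real.exp (-δ) ≤ M.det.re := by
    have hcont : Continuous fun ε : ℝ => (M + (ε : ℂ) • (1 : Matrix (Fin m) (Fin m) ℂ)).det.re := by
      fun_prop
    have htend := (hcont.tendsto 0).mono_left (nhdsWithin_le_nhds (s := Set.Ioi 0))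
    simp only [Complex.ofReal_zero, zero_smul, add_zero] at htend
    exact ge_of_tendsto htend (eventually_mem_nhdsWithin.mono fun ε hε => hMdet ε hε)
  have hconj : c * K - 1 = S * (M - 1) * S⁻¹ := by
    rw [Matrix.mul_sub, Matrix.sub_mul, Matrix.mul_one, mul_nonsing_inv _ hSdet, hM, hcS]
    simp only [Matrix.mul_assoc, mul_nonsing_inv _ hSdet, Matrix.mul_one]
  have hconj2 : ((c * K - 1) ^ 2).trace = ((M - 1) ^ 2).trace := by
    have h : (c * K - 1) ^ 2 = S * (M - 1) ^ 2 * S⁻¹ := by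
      rw [hconj, sq, sq]
      simp only [Matrix.mul_assoc, nonsing_inv_mul_cancel_left _ _ hSdet]
    rw [h, Matrix.trace_mul_comm, nonsing_inv_mul_cancel_left _ _ hSdet]
  rw [hconj2]
  exact hMpos.trace_sub_one_sq_le hMtr hδ1 hlim
end
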